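/- arXiv:2410.16745 — 5 statements merged into one kernel-verified Lean document; each statement's English description precedes it below -/
import Mathlib

section
/- For every demand lexicographic housing market ≽ (every agent has demand lexicographic preferences), the strong core SC(≽) is nonempty. -/
open Classical Function

/-- A strict linear order on `N`: `pref h h'` means `h` is strictly preferred to `h'`. -/
structure SLO (N : Type*) where
  pref : N → N → Prop
  trichotomous : ∀ a b, pref a b ∨ a = b ∨ pref b a
  irrefl : ∀ a, ¬ pref a a
  trans : ∀ a b c, pref a b → pref b c → pref a c

/-- A total preorder on `N`: `ge j k` means `j` is weakly preferred to `k`. -/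
structure TPO (N : Type*) where
  ge : N → N → Prop
  total : ∀ a b, ge a b ∨ ge b a
  trans : ∀ a b c, ge a b → ge b c → ge a c

/-- A demand lexicographic preference: a strict demand order over houses together with a
(possibly weak) total supply preorder over agents, compared lexicographically demand-first. -/
structure DemLexPref (N : Type*) where
  dem : SLO N
  sup : TPO N

variable {N : Type*}

/-- `a ≻ᵢ b`: agent `i` strictly prefers allocation `a` to allocation `b`
(houses are identified with their owners; agent `i`'s house is `i`; the endowment
allocation is the identity permutation). -/
def DemLexPref.SPref (P : DemLexPref N) (i : N) (a b : Equiv.Perm N) : Prop :=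
  P.dem.pref (a i) (b i) ∨
    (a i = b i ∧ P.sup.ge (a.symm i) (b.symm i) ∧ ¬ P.sup.ge (b.symm i) (a.symm i))

/-- `a ≽ᵢ b`: agent `i` weakly prefers allocation `a` to allocation `b`. -/
def DemLexPref.WPref (P : DemLexPref N) (i : N) (a b : Equiv.Perm N) : Prop :=
  P.dem.pref (a i) (b i) ∨ (a i = b i ∧ P.sup.ge (a.symm i) (b.symm i))

section Props
variable [DecidableEq N]

/-- Coalition `S` weakly blocks allocation `a` at market `P`. -/
def WeaklyBlocks (P : N → DemLexPref N) (S : Finset N) (a : Equiv.Perm N) : Prop :=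
  S.Nonempty ∧ ∃ b : Equiv.Perm N, S.image ⇑b = S ∧
    (∀ i ∈ S, (P i).WPref i b a) ∧ ∃ j ∈ S, (P j).SPref j b a

/-- `a` is a strong core allocation of market `P`. -/
def IsStrongCore (P : N → DemLexPref N) (a : Equiv.Perm N) : Prop :=
  ∀ S : Finset N, ¬ WeaklyBlocks P S a

/-- `a` is individually rational: every agent weakly prefers `a` to the endowment
allocation (the identity permutation). -/
def IndRational (P : N → DemLexPref N) (a : Equiv.Perm N) : Prop :=
  ∀ i : N, (P i).WPref i a 1

/-- `b` Pareto dominates `a`. -/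
def ParetoDom (P : N → DemLexPref N) (b a : Equiv.Perm N) : Prop :=
  (∀ i : N, (P i).WPref i b a) ∧ ∃ j : N, (P j).SPref j b a

/-- `a` is Pareto efficient. -/
def ParetoEff (P : N → DemLexPref N) (a : Equiv.Perm N) : Prop :=
  ¬ ∃ b : Equiv.Perm N, ParetoDom P b a

/-- `a` is pair efficient: no two agents can both strictly gain by swapping their assigned
houses in such a way that the resulting allocation Pareto dominates `a`. -/
def PairEff (P : N → DemLexPref N) (a : Equiv.Perm N) : Prop :=
  ¬ ∃ i j : N, i ≠ j ∧ (P i).SPref i (a * Equiv.swap i j) a ∧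
    (P j).SPref j (a * Equiv.swap i j) a ∧ ParetoDom P (a * Equiv.swap i j) a

/-- `a` is pairwise stable: no two agents can both strictly gain by swapping their
assigned houses. -/
def PairwiseStable (P : N → DemLexPref N) (a : Equiv.Perm N) : Prop :=
  ¬ ∃ i j : N, i ≠ j ∧ (P i).SPref i (a * Equiv.swap i j) a ∧
    (P j).SPref j (a * Equiv.swap i j) a

/-- `a` is stable: no coalition can reallocate the houses it receives at `a` so as to make
all of its members strictly better off. -/
def Stable (P : N → DemLexPref N) (a : Equiv.Perm N) : Prop :=
  ¬ ∃ (b : Equiv.Perm N) (S : Finset N), S.Nonempty ∧ (∀ k ∉ S, b k = a k) ∧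
      S.image ⇑b = S.image ⇑a ∧ ∀ i ∈ S, (P i).SPref i b a

end Props

/-- A strict linear order has a top element on every nonempty finite set. -/
theorem SLO.exists_top (L : SLO N) (M : Finset N) (hM : M.Nonempty) :
    ∃ x ∈ M, ∀ y ∈ M, ¬ L.pref y x := by
  induction hM using Finset.Nonempty.cons_induction with
  | singleton a => exact ⟨a, by simp, by simpa using L.irrefl a⟩
  | cons a s _ _ ih =>
    obtain ⟨x, hx, hmax⟩ := ih
    by_cases hax : L.pref a x
    · refine ⟨a, by simp, fun y hy hya => ?_⟩
      rcases Finset.mem_cons.1 hy with rfl | hy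
      · exact L.irrefl _ hya
      · exact hmax y hy (L.trans _ _ _ hya hax)
    · refine ⟨x, by simp [hx], fun y hy => ?_⟩
      rcases Finset.mem_cons.1 hy with rfl | hy
      · exact hax
      · exact hmax y hy

/-- A self-map of a nonempty finite type has a periodic point. -/
theorem Function.periodicPts_nonempty_of_finite {α : Type*} [Finite α] [Nonempty α]
    (f : α → α) : (periodicPts f).Nonempty := by
  obtain ⟨x⟩ := ‹Nonempty α›
  obtain ⟨m, n, hmn, h⟩ := Finite.exists_ne_map_eq_of_infinite fun k : ℕ => f^[k] x
  wlog hlt : m < n generalizing m n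
  · exact this n m hmn.symm h.symm (by lia)
  refine ⟨f^[m] x, mk_mem_periodicPts (n := n - m) (by lia) ?_⟩
  change f^[n - m] (f^[m] x) = f^[m] x
  rw [← iterate_add_apply, Nat.sub_add_cancel hlt.le]
  exact h.symm

/-- Top trading cycles restricted to a set `M` of agents: there is a permutation of `M` that
agrees with every reallocation within a subset of `M` which is weakly preferred, in terms
of demand, by all members of that subset. -/
theorem exists_perm_eq_of_weakly_preferred [Finite N] (L : N → SLO N) (M : Finset N) :
    ∃ a : Equiv.Perm N, (∀ i ∈ M, a i ∈ M) ∧ (∀ i ∉ M, a i = i) ∧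
      ∀ S ⊆ M, ∀ b : Equiv.Perm N, (∀ i ∈ S, b i ∈ S) →
        (∀ i ∈ S, (L i).pref (b i) (a i) ∨ b i = a i) → ∀ i ∈ S, b i = a i := by
  induction M using Finset.strongInduction with
  | H M ih =>
  rcases M.eq_empty_or_nonempty with rfl | hM
  · exact ⟨1, by simp, by simp, fun S hS b _ _ i hi => absurd (hS hi) (by simp)⟩
  choose f hfM hftop using fun i => (L i).exists_top M hM
  have : Nonempty N := hM.to_type
  have hbij := bijOn_periodicPts f
  have hCM : ∀ i ∈ periodicPts f, i ∈ M := fun i hi => by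
    obtain ⟨j, _, rfl⟩ := hbij.surjOn hi
    exact hfM j
  obtain ⟨c, hc⟩ := periodicPts_nonempty_of_finite f
  obtain ⟨a', ha'M, ha'fix, ha'⟩ := ih (M.filter (· ∉ periodicPts f))
    (Finset.filter_ssubset.2 ⟨c, hCM c hc, by simpa using hc⟩)
  have ha'C : ∀ i ∉ periodicPts f, a' i ∉ periodicPts f := fun i hi => by
    by_cases hiM : i ∈ M
    · exact (Finset.mem_filter.1 (ha'M i (Finset.mem_filter.2 ⟨hiM, hi⟩))).2
    · rwa [ha'fix i (by simp [hiM])]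
  let g : N → N := fun i => if i ∈ periodicPts f then f i else a' i
  have hg : ∀ i ∈ periodicPts f, g i = f i := fun i hi => if_pos hi
  have hg' : ∀ i ∉ periodicPts f, g i = a' i := fun i hi => if_neg hi
  have hinj : Injective g := fun i j hij => by
    by_cases hi : i ∈ periodicPts f <;> by_cases hj : j ∈ periodicPts f
    · rw [hg i hi, hg j hj] at hij
      exact hbij.injOn hi hj hij
    · rw [hg i hi, hg' j hj] at hij
      exact absurd (hij ▸ hbij.mapsTo hi) (ha'C j hj)
    · rw [hg' i hi, hg j hj] at hij
      exact absurd (hij.symm ▸ hbij.mapsTo hj) (ha'C i hi)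
    · rw [hg' i hi, hg' j hj] at hij
      exact a'.injective hij
  refine ⟨Equiv.ofBijective g (Finite.injective_iff_bijective.1 hinj), ?_, ?_, ?_⟩
  · intro i hi
    change g i ∈ M
    by_cases hiC : i ∈ periodicPts f
    · rw [hg i hiC]
      exact hfM i
    · rw [hg' i hiC]
      exact (Finset.mem_filter.1 (ha'M i (Finset.mem_filter.2 ⟨hi, hiC⟩))).1
  · intro i hi
    change g i = i
    rw [hg' i fun h => hi (hCM i h), ha'fix i (by simp [hi])]
  · intro S hSM b hbS hpref
    change ∀ i ∈ S, (L i).pref (b i) (g i) ∨ b i = g i at hpref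
    change ∀ i ∈ S, b i = g i
    have hSC : ∀ i ∈ S, i ∈ periodicPts f → b i = f i := fun i hi hiC => by
      have := hpref i hi
      rw [hg i hiC] at this
      exact this.resolve_left (hftop i _ (hSM (hbS i hi)))
    have hsurj : Set.SurjOn b (S.filter (· ∈ periodicPts f)) (S.filter (· ∈ periodicPts f)) :=
      Finset.surjOn_of_injOn_of_card_le b
        (fun i hi => by
          obtain ⟨hi, hiC⟩ := Finset.mem_filter.1 hi
          exact Finset.mem_filter.2 ⟨hbS i hi, hSC i hi hiC ▸ hbij.mapsTo hiC⟩)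
        b.injective.injOn le_rfl
    have hrest := ha' (S.filter (· ∉ periodicPts f)) (Finset.filter_subset_filter _ hSM) b
      (fun i hi => by
        obtain ⟨hi, hiC⟩ := Finset.mem_filter.1 hi
        refine Finset.mem_filter.2 ⟨hbS i hi, fun hbC => hiC ?_⟩
        obtain ⟨j, hj, hji⟩ := hsurj (Finset.mem_filter.2 ⟨hbS i hi, hbC⟩)
        exact b.injective hji ▸ (Finset.mem_filter.1 hj).2)
      (fun i hi => by
        obtain ⟨hi, hiC⟩ := Finset.mem_filter.1 hi
        exact hg' i hiC ▸ hpref i hi)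
    intro i hi
    by_cases hiC : i ∈ periodicPts f
    · rw [hSC i hi hiC, hg i hiC]
    · rw [hg' i hiC, hrest i (Finset.mem_filter.2 ⟨hi, hiC⟩)]

/-- For every demand lexicographic housing market, the strong core is
nonempty. -/
theorem strongCore_nonempty {N : Type*} [Fintype N] [DecidableEq N] [Nonempty N]
    (P : N → DemLexPref N) : ∃ a : Equiv.Perm N, IsStrongCore P a := by
  obtain ⟨a, -, -, ha⟩ := exists_perm_eq_of_weakly_preferred (fun i => (P i).dem) Finset.univ
  refine ⟨a, ?_⟩
  rintro S ⟨-, b, hbS, hweak, j, hj, hstrict⟩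
  have heq := ha S (Finset.subset_univ S) b
    (fun i hi => hbS ▸ Finset.mem_image_of_mem b hi) fun i hi => (hweak i hi).imp_right And.left
  rcases hstrict with h | ⟨-, hge, hnge⟩
  · exact (P j).dem.irrefl _ (heq j hj ▸ h)
  · obtain ⟨k, hk, hkj⟩ := Finset.mem_image.1 (hbS.symm ▸ hj : j ∈ S.image b)
    have hsymm : a.symm j = b.symm j := by
      rw [b.symm_apply_eq.2 hkj.symm, a.symm_apply_eq, ← heq k hk, hkj]
    rw [hsymm] at hge hnge
    exact hnge hge
end

section
/- If φ and ψ are two rules on the domain of demand lexicographic housing markets that both satisfy individual rationality, pair efficiency, and strategy-proofness, then φ = ψ, i.e., φ(≽) = ψ(≽) for every demand lexicographic market ≽. -/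
open Classical Function

variable {N : Type*}

/-- The demand order obtained by moving `x` to the top. -/
def SLO.raise {N : Type*} (R : SLO N) (x : N) : SLO N where
  pref a b := b ≠ x ∧ (a = x ∨ R.pref a b)
  trichotomous a b := by
    have := R.trichotomous a b
    by_cases ha : a = x <;> by_cases hb : b = x <;> simp_all
  irrefl a h := by
    rcases h with ⟨h, h' | h'⟩
    · exact h h'
    · exact R.irrefl a h'
  trans a b c hab hbc := by
    refine ⟨hbc.1, ?_⟩
    rcases hab.2 with h | h
    · exact Or.inl h
    · rcases hbc.2 with hb | hb
      · exact absurd hb hab.1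
      · exact Or.inr (R.trans a b c h hb)

/-- The supply preorder that is indifferent between all agents. -/
def TPO.indifferent (N : Type*) : TPO N where
  ge _ _ := True
  total _ _ := Or.inl trivial
  trans _ _ _ _ _ := trivial

theorem SLO.asymm {N : Type*} (R : SLO N) {a b : N} (h : R.pref a b) : ¬ R.pref b a :=
  fun hba => R.irrefl a (R.trans a b a h hba)

/-- Agent `i` ranks `t` first and her own house next, and has no supply preferences. -/
structure DemLexPref.IsTruncated {N : Type*} (P : DemLexPref N) (i t : N) : Prop where
  top : ∀ h, h ≠ t → P.dem.pref t h
  own : ∀ h, h ≠ t → h ≠ i → P.dem.pref i h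
  sup : ∀ j k, P.sup.ge j k

/-- The preference truncated at `t`, built from the demand order of `P`. -/
def DemLexPref.truncate {N : Type*} (P : DemLexPref N) (i t : N) : DemLexPref N where
  dem := (P.dem.raise i).raise t
  sup := TPO.indifferent N

theorem DemLexPref.truncate_isTruncated {N : Type*} (P : DemLexPref N) (i t : N) :
    (P.truncate i t).IsTruncated i t where
  top _ h := ⟨h, Or.inl rfl⟩
  own _ h h' := ⟨h, Or.inr ⟨h', Or.inl rfl⟩⟩
  sup _ _ := trivial

theorem DemLexPref.IsTruncated.eq_or_eq {N : Type*} {P : DemLexPref N} {i t : N}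
    (hP : P.IsTruncated i t) {a : Equiv.Perm N} (h : P.WPref i a 1) : a i = t ∨ a i = i := by
  by_contra! hne
  rcases h with h | h
  · exact P.dem.asymm h (hP.own _ hne.1 hne.2)
  · exact hne.2 h.1

theorem DemLexPref.IsTruncated.eq_top {N : Type*} {P : DemLexPref N} {i t : N}
    (hP : P.IsTruncated i t) {a b : Equiv.Perm N} (h : P.WPref i a b) (hb : b i = t) :
    a i = t := by
  by_contra hne
  rcases h with h | h
  · exact P.dem.asymm h (hb ▸ hP.top _ hne)
  · exact hne (h.1.trans hb)

/-- An individually rational, pair efficient and strategy-proof rule. -/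
structure IsEfficientRule {N : Type*} [DecidableEq N]
    (φ : (N → DemLexPref N) → Equiv.Perm N) : Prop where
  indRational : ∀ P, IndRational P (φ P)
  pairEff : ∀ P, PairEff P (φ P)
  strategyProof : ∀ (P : N → DemLexPref N) (i : N) (Q : DemLexPref N),
    (P i).WPref i (φ P) (φ (Function.update P i Q))

/-- An agent `j` who keeps her own house and an agent `i` cannot both gain in demand by a swap if
the house of `i` is her own or its owner has no supply preferences. -/
theorem PairEff.not_swap {N : Type*} [DecidableEq N] {P : N → DemLexPref N} {a : Equiv.Perm N}
    (ha : PairEff P a) {i j : N} (hij : i ≠ j) (hj : a j = j)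
    (hi : a i = i ∨ ∀ x y, (P (a i)).sup.ge x y)
    (hpi : (P i).dem.pref j (a i)) (hpj : (P j).dem.pref (a i) j) : False := by
  have hsi : (P i).SPref i (a * Equiv.swap i j) a := Or.inl (by simpa [hj] using hpi)
  have hsj : (P j).SPref j (a * Equiv.swap i j) a := Or.inl (by simpa [hj] using hpj)
  refine ha ⟨i, j, hij, hsi, hsj, fun k => ?_, i, hsi⟩
  by_cases hki : k = i
  · subst hki
    exact Or.inl (by simpa [hj] using hpi)
  by_cases hkj : k = j
  · subst hkj
    exact Or.inl (by simpa [hj] using hpj)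
  refine Or.inr ⟨by simp [Equiv.swap_apply_of_ne_of_ne hki hkj], ?_⟩
  by_cases hk : k = a i
  · subst hk
    exact hi.resolve_left hki _ _
  · have h₁ : a.symm k ≠ i := fun h => hk (by rw [← h, Equiv.apply_symm_apply])
    have h₂ : a.symm k ≠ j := fun h => hkj (by rw [← hj, ← h, Equiv.apply_symm_apply])
    have h₃ : (a * Equiv.swap i j).symm k = a.symm k := by
      rw [Equiv.symm_apply_eq, Equiv.Perm.mul_apply, Equiv.swap_apply_of_ne_of_ne h₁ h₂,
        Equiv.apply_symm_apply]
    rw [h₃]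
    exact ((P k).sup.total _ _).elim id id

/-- If every agent moved by `σ` reports a preference truncated at her `σ`-house, then the rule
carries out all the trades in `σ`. -/
theorem IsEfficientRule.apply_eq_of_isTruncated {N : Type*} [Fintype N] [DecidableEq N]
    {φ : (N → DemLexPref N) → Equiv.Perm N} (hφ : IsEfficientRule φ) (P : N → DemLexPref N)
    (σ : Equiv.Perm N) (hσ : ∀ i, σ i ≠ i → (P i).IsTruncated i (σ i)) (i : N) (hi : σ i ≠ i) :
    φ P i = σ i := by
  induction hn : σ.support.card using Nat.strong_induction_on generalizing P σ i with
  | _ n ih =>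
  subst hn
  by_contra hne
  have hown : φ P i = i := ((hσ i hi).eq_or_eq (hφ.indRational P i)).resolve_left hne
  have hi' : σ (σ i) ≠ σ i := fun h => hi (σ.injective h)
  by_cases hcyc : σ (σ i) = i
  · have hj : φ P (σ i) = σ i := by
      refine ((hσ _ hi').eq_or_eq (hφ.indRational P _)).resolve_left fun h => hi ?_
      exact (φ P).injective (by rw [h, hcyc, hown])
    refine (hφ.pairEff P).not_swap hi.symm hj (Or.inl hown) ?_ ?_
    · rw [hown]
      exact (hσ i hi).top i hi.symm
    · rw [hown]
      have := (hσ _ hi').top (σ i) hi'.symm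
      rwa [hcyc] at this
  · set j := σ i with hjdef
    set k := σ j with hkdef
    let Q : DemLexPref N := ⟨(((P i).dem.raise i).raise k).raise j, TPO.indifferent N⟩
    have hQj : ∀ h, h ≠ j → Q.dem.pref j h := fun h hh => ⟨hh, Or.inl rfl⟩
    have hQk : ∀ h, h ≠ j → h ≠ k → Q.dem.pref k h :=
      fun h hh hh' => ⟨hh, Or.inr ⟨hh', Or.inl rfl⟩⟩
    have hQi : ∀ h, h ≠ j → h ≠ k → h ≠ i → Q.dem.pref i h :=
      fun h h₁ h₂ h₃ => ⟨h₁, Or.inr ⟨h₂, Or.inr ⟨h₃, Or.inl rfl⟩⟩⟩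
    set P₁ := Function.update P i Q with hP₁
    have hP₁i : P₁ i = Q := by simp [hP₁]
    have hP₁' : ∀ x, x ≠ i → P₁ x = P x := fun x hx => by simp [hP₁, hx]
    have hnj : φ P₁ i ≠ j := fun h =>
      hne ((hσ i hi).eq_top (hφ.strategyProof P i Q) h)
    have hnk : φ P₁ i ≠ k := by
      intro h
      have hj : φ P₁ j = j := by
        have hir := hφ.indRational P₁ j
        rw [hP₁' j hi] at hir
        refine ((hσ j hi').eq_or_eq hir).resolve_left fun h' => hi ?_
        exact (φ P₁).injective (h'.trans h.symm)
      refine (hφ.pairEff P₁).not_swap hi.symm hj (Or.inr fun x y => ?_) ?_ ?_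
      · rw [h, hP₁' k hcyc]
        exact (hσ k fun h => hi' (σ.injective h)).sup x y
      · rw [h, hP₁i]
        exact hQj k hi'
      · rw [h, hP₁' j hi]
        exact (hσ j hi').top j hi'.symm
    have hi₁ : φ P₁ i = i := by
      by_contra hni
      have hir := hφ.indRational P₁ i
      rw [hP₁i] at hir
      rcases hir with h | h
      · exact Q.dem.asymm h (hQi _ hnj hnk hni)
      · exact hni h.1
    set P₂ := Function.update P i ((P i).truncate i k) with hP₂
    have hP₂i : φ P₂ i = k := by
      have hσi : (σ * Equiv.swap i j) i = k := by simp [hkdef]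
      have hσj : (σ * Equiv.swap i j) j = j := by simp [← hjdef]
      have hσx : ∀ x, x ≠ i → x ≠ j → (σ * Equiv.swap i j) x = σ x := fun x h h' => by
        simp [Equiv.swap_apply_of_ne_of_ne h h']
      have hcard : (σ * Equiv.swap i j).support.card < σ.support.card := by
        refine Finset.card_lt_card (Finset.ssubset_iff_of_subset ?_ |>.2 ⟨j, ?_, ?_⟩)
        · intro x hx
          rw [Equiv.Perm.mem_support] at hx ⊢
          by_cases hxi : x = i
          · exact hxi ▸ hi
          · by_cases hxj : x = j
            · exact hxj ▸ hi'
            · rwa [hσx x hxi hxj] at hx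
        · exact Equiv.Perm.mem_support.2 hi'
        · simp only [Equiv.Perm.mem_support, not_not]
          exact hσj
      refine (ih _ hcard P₂ _ ?_ i (by rw [hσi]; exact hcyc) rfl).trans hσi
      intro x hx
      by_cases hxi : x = i
      · subst hxi
        rw [hσi, hP₂, Function.update_self]
        exact (P x).truncate_isTruncated x k
      · by_cases hxj : x = j
        · exact absurd (hxj ▸ hσj) hx
        · rw [hσx x hxi hxj] at hx ⊢
          rw [hP₂, Function.update_of_ne hxi]
          exact hσ x hx
    have hsp := hφ.strategyProof P₁ i ((P i).truncate i k)
    rw [hP₁, Function.update_idem, ← hP₁, ← hP₂, hP₁i] at hsp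
    rcases hsp with h | h
    · rw [hi₁, hP₂i] at h
      exact Q.dem.asymm h (hQk i hi.symm (Ne.symm hcyc))
    · exact hcyc (hP₂i.symm.trans (h.1.symm.trans hi₁))

/-- If all agents treated differently by two rules have truncated preferences, then no
agent trades under the first rule while keeping her house under the second one. -/
theorem IsEfficientRule.apply_eq_self {N : Type*} [Fintype N] [DecidableEq N]
    {φ ψ : (N → DemLexPref N) → Equiv.Perm N} (hφ : IsEfficientRule φ) (hψ : IsEfficientRule ψ)
    (P : N → DemLexPref N) (hP : ∀ i, φ P i ≠ ψ P i → ∃ t, (P i).IsTruncated i t) (i : N)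
    (hi : ψ P i = i) : φ P i = i := by
  by_contra hne
  let p : N → Prop := fun x => φ P x ≠ x ∧ ψ P x = x
  have htop : ∀ x, p x → (P x).IsTruncated x (φ P x) := by
    intro x hx
    obtain ⟨t, ht⟩ := hP x (by rw [hx.2]; exact hx.1)
    rwa [(ht.eq_or_eq (hφ.indRational P x)).resolve_right hx.1]
  have hinv : ∀ x, p x → p ((φ P).symm x) := by
    intro x hx
    obtain ⟨y, rfl⟩ := (φ P).surjective x
    rw [Equiv.symm_apply_apply]
    have hy : φ P y ≠ y := fun h => hx.1 (by rw [h, h])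
    have hψy : ψ P y ≠ φ P y := fun h => hy ((ψ P).injective (by rw [hx.2, h]))
    obtain ⟨t, ht⟩ := hP y hψy.symm
    have hφt := (ht.eq_or_eq (hφ.indRational P y)).resolve_right hy
    exact ⟨hy, (ht.eq_or_eq (hψ.indRational P y)).resolve_left (hφt ▸ hψy)⟩
  have hmap : ∀ x, p (φ P x) ↔ p x := by
    refine fun x => ⟨fun h => by simpa using hinv _ h, fun h => ?_⟩
    simpa using Equiv.Perm.perm_symm_on_of_perm_on_finite hinv h
  let σ : Equiv.Perm N := Equiv.Perm.ofSubtype ((φ P).subtypePerm hmap)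
  have hσ : ∀ x, p x → σ x = φ P x := fun x hx => by
    simp [σ, Equiv.Perm.ofSubtype_apply_of_mem _ hx]
  have hσ' : ∀ x, σ x ≠ x → p x := fun x hx => by
    by_contra h
    exact hx (Equiv.Perm.ofSubtype_apply_of_not_mem _ h)
  have hpi : p i := ⟨hne, hi⟩
  have := hψ.apply_eq_of_isTruncated P σ
    (fun x hx => by rw [hσ x (hσ' x hx)]; exact htop x (hσ' x hx)) i (by rw [hσ i hpi]; exact hne)
  rw [hσ i hpi, hi] at this
  exact hne this.symm

/-- Truncating an agent who prefers her house under `φ` preserves the disagreement of the rules. -/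
theorem IsEfficientRule.truncate_ne {N : Type*} [DecidableEq N]
    {φ ψ : (N → DemLexPref N) → Equiv.Perm N} (hφ : IsEfficientRule φ) (hψ : IsEfficientRule ψ)
    (P : N → DemLexPref N) (i : N) (hi : (P i).dem.pref (φ P i) (ψ P i)) :
    φ (Function.update P i ((P i).truncate i (φ P i))) ≠
      ψ (Function.update P i ((P i).truncate i (φ P i))) := by
  intro heq
  have hφi : φ (Function.update P i ((P i).truncate i (φ P i))) i = φ P i := by
    have h := hφ.strategyProof (Function.update P i ((P i).truncate i (φ P i))) i (P i)
    rw [Function.update_idem, Function.update_eq_self, Function.update_self] at h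
    exact ((P i).truncate_isTruncated i _).eq_top h rfl
  have h := hψ.strategyProof P i ((P i).truncate i (φ P i))
  rw [← heq] at h
  rcases h with h | h
  · rw [hφi] at h
    exact (P i).dem.asymm hi h
  · rw [h.1, hφi] at hi
    exact (P i).dem.irrefl _ hi

/-- Truncating an agent with a non-truncated preference lowers the number of such agents. -/
theorem card_not_isTruncated_update_lt {N : Type*} [Fintype N] [DecidableEq N]
    (P : N → DemLexPref N) (i t : N) (hi : ¬ ∃ t, (P i).IsTruncated i t) :
    (Finset.univ.filter fun j =>
      ¬ ∃ s, (Function.update P i ((P i).truncate i t) j).IsTruncated j s).card <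
      (Finset.univ.filter fun j => ¬ ∃ s, (P j).IsTruncated j s).card := by
  have hself : ∃ s, (Function.update P i ((P i).truncate i t) i).IsTruncated i s :=
    ⟨t, by rw [Function.update_self]; exact (P i).truncate_isTruncated i t⟩
  refine Finset.card_lt_card (Finset.ssubset_iff_of_subset ?_ |>.2 ⟨i, ?_, ?_⟩)
  · intro j hj
    rw [Finset.mem_filter] at hj ⊢
    have hji : j ≠ i := fun h => hj.2 (h ▸ hself)
    rwa [Function.update_of_ne hji] at hj
  · exact Finset.mem_filter.2 ⟨Finset.mem_univ i, hi⟩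
  · exact fun h => (Finset.mem_filter.1 h).2 hself

theorem IsEfficientRule.apply_eq_apply {N : Type*} [Fintype N] [DecidableEq N]
    {φ ψ : (N → DemLexPref N) → Equiv.Perm N} (hφ : IsEfficientRule φ) (hψ : IsEfficientRule ψ)
    (P : N → DemLexPref N) : φ P = ψ P := by
  induction hn : (Finset.univ.filter fun j => ¬ ∃ s, (P j).IsTruncated j s).card
    using Nat.strong_induction_on generalizing P with
  | _ n ih =>
  subst hn
  by_cases hP : ∀ i, φ P i ≠ ψ P i → ∃ t, (P i).IsTruncated i t
  · ext i
    by_contra hne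
    obtain ⟨t, ht⟩ := hP i hne
    have h₁ := hφ.apply_eq_self hψ P hP i
    have h₂ := hψ.apply_eq_self hφ P (fun j hj => hP j hj.symm) i
    rcases ht.eq_or_eq (hψ.indRational P i) with h | h
    · rcases ht.eq_or_eq (hφ.indRational P i) with h' | h'
      · exact hne (h'.trans h.symm)
      · exact hne (h'.trans (h₂ h').symm)
    · exact hne ((h₁ h).trans h.symm)
  · push Not at hP
    obtain ⟨i, hne, hi⟩ := hP
    have hlt := fun t => card_not_isTruncated_update_lt P i t (not_exists.2 hi)
    rcases (P i).dem.trichotomous (φ P i) (ψ P i) with h | h | h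
    · exact absurd (ih _ (hlt _) _ rfl) (hφ.truncate_ne hψ P i h)
    · exact absurd h hne
    · exact absurd (ih _ (hlt _) _ rfl).symm (hψ.truncate_ne hφ P i h)

/-- Any two individually rational, pair efficient and strategy-proof
rules on the domain of demand lexicographic markets coincide. -/
theorem rule_uniqueness {N : Type*} [Fintype N] [DecidableEq N] [Nonempty N]
    (φ ψ : (N → DemLexPref N) → Equiv.Perm N)
    (hφIR : ∀ P, IndRational P (φ P)) (hφPE : ∀ P, PairEff P (φ P))
    (hφSP : ∀ (P : N → DemLexPref N) (i : N) (P' : DemLexPref N),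
      (P i).WPref i (φ P) (φ (Function.update P i P')))
    (hψIR : ∀ P, IndRational P (ψ P)) (hψPE : ∀ P, PairEff P (ψ P))
    (hψSP : ∀ (P : N → DemLexPref N) (i : N) (P' : DemLexPref N),
      (P i).WPref i (ψ P) (ψ (Function.update P i P'))) :
    φ = ψ := by
  funext P
  exact IsEfficientRule.apply_eq_apply ⟨hφIR, hφPE, hφSP⟩ ⟨hψIR, hψPE, hψSP⟩ P
end

section
/- If N has at least 3 agents, then no rule on the domain of mixed lexicographic housing markets satisfies individual rationality, Pareto efficiency, and strategy-proofness; likewise, no rule on this domain satisfies individual rationality, pairwise stability, and strategy-proofness. -/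
open Classical Function

/-- A mixed lexicographic preference: strict demand and supply orders, compared
lexicographically demand-first if `demandFirst = true` (strict demand lexicographic),
and supply-first otherwise (strict supply lexicographic). -/
structure MixedLexPref (N : Type*) where
  dem : SLO N
  sup : SLO N
  demandFirst : Bool

variable {N : Type*}

/-- `a ≻ᵢ b` for mixed lexicographic preferences. -/
def MixedLexPref.SPref (P : MixedLexPref N) (i : N) (a b : Equiv.Perm N) : Prop :=
  if P.demandFirst then
    P.dem.pref (a i) (b i) ∨ (a i = b i ∧ P.sup.pref (a.symm i) (b.symm i))
  else
    P.sup.pref (a.symm i) (b.symm i) ∨ (a.symm i = b.symm i ∧ P.dem.pref (a i) (b i))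

/-- `a ≽ᵢ b` for mixed lexicographic preferences. -/
def MixedLexPref.WPref (P : MixedLexPref N) (i : N) (a b : Equiv.Perm N) : Prop :=
  P.SPref i a b ∨ (a i = b i ∧ a.symm i = b.symm i)

section MProps
variable [DecidableEq N]

/-- `a` is individually rational at the mixed market `P`. -/
def MIndRational (P : N → MixedLexPref N) (a : Equiv.Perm N) : Prop :=
  ∀ i : N, (P i).WPref i a 1

/-- `b` Pareto dominates `a` at the mixed market `P`. -/
def MParetoDom (P : N → MixedLexPref N) (b a : Equiv.Perm N) : Prop :=
  (∀ i : N, (P i).WPref i b a) ∧ ∃ j : N, (P j).SPref j b a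

/-- `a` is Pareto efficient at the mixed market `P`. -/
def MParetoEff (P : N → MixedLexPref N) (a : Equiv.Perm N) : Prop :=
  ¬ ∃ b : Equiv.Perm N, MParetoDom P b a

/-- `a` is pair efficient at the mixed market `P`. -/
def MPairEff (P : N → MixedLexPref N) (a : Equiv.Perm N) : Prop :=
  ¬ ∃ i j : N, i ≠ j ∧ (P i).SPref i (a * Equiv.swap i j) a ∧
    (P j).SPref j (a * Equiv.swap i j) a ∧ MParetoDom P (a * Equiv.swap i j) a

/-- `a` is pairwise stable at the mixed market `P`. -/
def MPairwiseStable (P : N → MixedLexPref N) (a : Equiv.Perm N) : Prop :=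
  ¬ ∃ i j : N, i ≠ j ∧ (P i).SPref i (a * Equiv.swap i j) a ∧
    (P j).SPref j (a * Equiv.swap i j) a

end MProps

/-- The order induced by an injective rank function, smaller ranks being better. -/
def SLO.ofRank {α : Type*} (r : α → ℕ) (hr : Injective r) : SLO α where
  pref x y := r x < r y
  trichotomous x y := by
    rcases lt_trichotomy (r x) (r y) with h | h | h
    exacts [Or.inl h, Or.inr (Or.inl (hr h)), Or.inr (Or.inr h)]
  irrefl x := lt_irrefl (r x)
  trans _ _ _ := lt_trans

/-- A mixed lexicographic preference in a market with three agents, given by rank vectors. -/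
structure RankPref where
  dem : Fin 3 → Fin 3
  sup : Fin 3 → Fin 3
  demandFirst : Bool
  dem_injective : Injective dem := by decide
  sup_injective : Injective sup := by decide

namespace RankPref

/-- Strict preference of agent `i` between allocations in a three-agent market. -/
def Strict (p : RankPref) (i : Fin 3) (σ τ : Equiv.Perm (Fin 3)) : Prop :=
  if p.demandFirst then
    p.dem (σ i) < p.dem (τ i) ∨ (σ i = τ i ∧ p.sup (σ.symm i) < p.sup (τ.symm i))
  else
    p.sup (σ.symm i) < p.sup (τ.symm i) ∨ (σ.symm i = τ.symm i ∧ p.dem (σ i) < p.dem (τ i))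

/-- Weak preference of agent `i` between allocations in a three-agent market. -/
def Weak (p : RankPref) (i : Fin 3) (σ τ : Equiv.Perm (Fin 3)) : Prop :=
  p.Strict i σ τ ∨ (σ i = τ i ∧ σ.symm i = τ.symm i)

instance (p : RankPref) (i : Fin 3) (σ τ : Equiv.Perm (Fin 3)) : Decidable (p.Strict i σ τ) :=
  inferInstanceAs (Decidable (ite _ _ _))

instance (p : RankPref) (i : Fin 3) (σ τ : Equiv.Perm (Fin 3)) : Decidable (p.Weak i σ τ) :=
  inferInstanceAs (Decidable (_ ∨ _))

end RankPref

/-- The list of all permutations of three agents. -/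
def permTable : Fin 6 → Equiv.Perm (Fin 3) :=
  ![⟨![0, 1, 2], ![0, 1, 2], by decide, by decide⟩,
    ⟨![0, 2, 1], ![0, 2, 1], by decide, by decide⟩,
    ⟨![1, 0, 2], ![1, 0, 2], by decide, by decide⟩,
    ⟨![1, 2, 0], ![2, 0, 1], by decide, by decide⟩,
    ⟨![2, 0, 1], ![1, 2, 0], by decide, by decide⟩,
    ⟨![2, 1, 0], ![2, 1, 0], by decide, by decide⟩]

theorem permTable_surjective : Surjective permTable := by
  have h : ∀ g : Fin 3 → Fin 3, Injective g → ∃ k, ∀ i, permTable k i = g i := by decide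
  intro σ
  obtain ⟨k, hk⟩ := h σ σ.injective
  exact ⟨k, Equiv.ext hk⟩

/-- Individual rationality in a three-agent market. -/
def RankRational (R : Fin 3 → RankPref) (σ : Equiv.Perm (Fin 3)) : Prop :=
  ∀ i, (R i).Weak i σ 1

/-- Pareto domination in a three-agent market. -/
def RankDom (R : Fin 3 → RankPref) (τ σ : Equiv.Perm (Fin 3)) : Prop :=
  (∀ i, (R i).Weak i τ σ) ∧ ∃ j, (R j).Strict j τ σ

/-- Individual rationality together with Pareto efficiency in a three-agent market. -/
def RankAdmissible (R : Fin 3 → RankPref) (σ : Equiv.Perm (Fin 3)) : Prop :=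
  RankRational R σ ∧ ¬ ∃ τ, RankDom R τ σ

/-- Existence of a blocking pair in a three-agent market. -/
def RankBlocked (R : Fin 3 → RankPref) (σ : Equiv.Perm (Fin 3)) : Prop :=
  ∃ i j, i ≠ j ∧ (R i).Strict i (σ * Equiv.swap i j) σ ∧ (R j).Strict j (σ * Equiv.swap i j) σ

instance (R : Fin 3 → RankPref) (σ : Equiv.Perm (Fin 3)) : Decidable (RankRational R σ) :=
  inferInstanceAs (Decidable (∀ _, _))

instance (R : Fin 3 → RankPref) (τ σ : Equiv.Perm (Fin 3)) : Decidable (RankDom R τ σ) :=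
  inferInstanceAs (Decidable (_ ∧ _))

instance (R : Fin 3 → RankPref) (σ : Equiv.Perm (Fin 3)) : Decidable (RankAdmissible R σ) :=
  decidable_of_iff (RankRational R σ ∧ ¬ ∃ k, RankDom R (permTable k) σ) <| by
    rw [RankAdmissible, permTable_surjective.exists]

instance (R : Fin 3 → RankPref) (σ : Equiv.Perm (Fin 3)) : Decidable (RankBlocked R σ) :=
  inferInstanceAs (Decidable (∃ _, _))

theorem exists_rankBlocked_of_rankRational :
    ∃ R : Fin 3 → RankPref, ∀ σ, RankRational R σ → RankBlocked R σ :=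
  ⟨![{ dem := ![0, 2, 1], sup := ![1, 0, 2], demandFirst := false },
     { dem := ![0, 1, 2], sup := ![0, 1, 2], demandFirst := false },
     { dem := ![0, 1, 2], sup := ![0, 1, 2], demandFirst := true }], permTable_surjective.forall.mpr (by decide)⟩

/-- A market in which every individually rational and efficient outcome is ruled out by
strategy-proofness with respect to a deviation of agent `0` or of agent `2`. -/
theorem exists_incompatible_deviations :
    ∃ (R : Fin 3 → RankPref) (p₀ p₂ : RankPref), ∀ σ, RankAdmissible R σ →
      (∀ τ, RankAdmissible (Function.update R 0 p₀) τ →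
        ¬ ((R 0).Weak 0 σ τ ∧ p₀.Weak 0 τ σ)) ∨
      (∀ τ, RankAdmissible (Function.update R 2 p₂) τ →
        ¬ ((R 2).Weak 2 σ τ ∧ p₂.Weak 2 τ σ)) := by
  simp only [permTable_surjective.forall]
  exact ⟨![{ dem := ![1, 2, 0], sup := ![0, 1, 2], demandFirst := true },
      { dem := ![0, 1, 2], sup := ![2, 0, 1], demandFirst := true },
      { dem := ![0, 1, 2], sup := ![0, 1, 2], demandFirst := true }],
    { dem := ![0, 2, 1], sup := ![1, 0, 2], demandFirst := false },
    { dem := ![0, 2, 1], sup := ![0, 1, 2], demandFirst := true }, by decide⟩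

section Embedding
variable {N : Type*} (f : Fin 3 ↪ N)

theorem viaEmbedding_symm (σ : Equiv.Perm (Fin 3)) :
    (σ.viaEmbedding f).symm = Equiv.Perm.viaEmbedding σ.symm f := rfl

theorem viaEmbedding_one : (1 : Equiv.Perm (Fin 3)).viaEmbedding f = 1 :=
  map_one (Equiv.Perm.viaEmbeddingHom f)

theorem viaEmbedding_mul_swap [DecidableEq N] (σ : Equiv.Perm (Fin 3)) (i j : Fin 3) :
    (σ * Equiv.swap i j).viaEmbedding f = σ.viaEmbedding f * Equiv.swap (f i) (f j) := by
  ext x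
  by_cases hx : ∃ k, f k = x
  · obtain ⟨k, rfl⟩ := hx
    rw [Equiv.Perm.mul_apply, ← f.injective.map_swap, Equiv.Perm.viaEmbedding_apply,
      Equiv.Perm.viaEmbedding_apply, Equiv.Perm.mul_apply]
  · have hk : ∀ k, x ≠ f k := fun k e => hx ⟨k, e.symm⟩
    rw [Equiv.Perm.mul_apply, Equiv.swap_apply_of_ne_of_ne (hk i) (hk j),
      Equiv.Perm.viaEmbedding_apply_of_notMem _ _ _ hx,
      Equiv.Perm.viaEmbedding_apply_of_notMem _ _ _ hx]

theorem exists_viaEmbedding_eq {a : Equiv.Perm N} (ha : ∀ x, (¬ ∃ i, f i = x) → a x = x) :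
    ∃ σ : Equiv.Perm (Fin 3), σ.viaEmbedding f = a := by
  have hr : ∀ i, ∃ j, f j = a (f i) := by
    intro i
    by_contra h
    exact h ⟨i, (a.injective (ha _ h)).symm⟩
  choose g hg using hr
  have hg_inj : Injective g := fun i j h => f.injective (a.injective (by rw [← hg, ← hg, h]))
  refine ⟨Equiv.ofBijective g (Finite.injective_iff_bijective.mp hg_inj), ?_⟩
  ext x
  by_cases hx : ∃ i, f i = x
  · obtain ⟨i, rfl⟩ := hx
    rw [Equiv.Perm.viaEmbedding_apply, Equiv.ofBijective_apply, hg]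
  · rw [Equiv.Perm.viaEmbedding_apply_of_notMem _ _ _ hx, ha x hx]

variable [Fintype N]

/-- The position of an element in a fixed enumeration of a finite type. -/
noncomputable def enumRank (x : N) : ℕ := Fintype.equivFin N x

theorem enumRank_injective : Injective (enumRank (N := N)) :=
  Fin.val_injective.comp (Fintype.equivFin N).injective

/-- Extends a rank vector on three agents, placing everyone else below them. -/
noncomputable def extendRank (r : Fin 3 → Fin 3) : N → ℕ :=
  Function.extend f (fun i => (r i : ℕ)) (fun x => 3 + enumRank x)

@[simp]
theorem extendRank_apply (r : Fin 3 → Fin 3) (i : Fin 3) : extendRank f r (f i) = r i :=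
  f.injective.extend_apply _ _ _

theorem extendRank_of_notMem (r : Fin 3 → Fin 3) {x : N} (hx : ¬ ∃ i, f i = x) :
    extendRank f r x = 3 + enumRank x :=
  Function.extend_apply' _ _ _ hx

theorem extendRank_injective {r : Fin 3 → Fin 3} (hr : Injective r) :
    Injective (extendRank f r) := by
  intro x y h
  by_cases hx : ∃ i, f i = x <;> by_cases hy : ∃ i, f i = y
  · obtain ⟨i, rfl⟩ := hx
    obtain ⟨j, rfl⟩ := hy
    simp only [extendRank_apply] at h
    rw [hr (Fin.ext h)]
  · obtain ⟨i, rfl⟩ := hx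
    rw [extendRank_apply, extendRank_of_notMem f r hy] at h
    have := (r i).isLt
    omega
  · obtain ⟨j, rfl⟩ := hy
    rw [extendRank_apply, extendRank_of_notMem f r hx] at h
    have := (r j).isLt
    omega
  · rw [extendRank_of_notMem f r hx, extendRank_of_notMem f r hy] at h
    exact enumRank_injective (Nat.add_left_cancel h)

/-- The preference on all of `N` extending a three-agent preference. -/
noncomputable def RankPref.toMixed (p : RankPref) : MixedLexPref N where
  dem := SLO.ofRank (extendRank f p.dem) (extendRank_injective f p.dem_injective)
  sup := SLO.ofRank (extendRank f p.sup) (extendRank_injective f p.sup_injective)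
  demandFirst := p.demandFirst

/-- An order whose best element is `x`. -/
noncomputable def SLO.top (x : N) : SLO N :=
  SLO.ofRank (fun y => if y = x then 0 else enumRank y + 1) (by
    intro y z h
    by_cases hy : y = x <;> by_cases hz : z = x <;> simp [hy, hz] at h ⊢
    exact enumRank_injective h)

theorem SLO.not_top_pref (x y : N) : ¬ (SLO.top x).pref y x := by
  simp [SLO.top, SLO.ofRank]

/-- The market on `N` in which agents outside the range of `f` prefer to keep their endowment. -/
noncomputable def extendMarket (R : Fin 3 → RankPref) : N → MixedLexPref N :=
  Function.extend f (fun i => (R i).toMixed f) (fun x => ⟨SLO.top x, SLO.top x, true⟩)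

@[simp]
theorem extendMarket_apply (R : Fin 3 → RankPref) (i : Fin 3) :
    extendMarket f R (f i) = (R i).toMixed f :=
  f.injective.extend_apply _ _ _

theorem extendMarket_of_notMem (R : Fin 3 → RankPref) {x : N} (hx : ¬ ∃ i, f i = x) :
    extendMarket f R x = ⟨SLO.top x, SLO.top x, true⟩ :=
  Function.extend_apply' _ _ _ hx

theorem extendMarket_update [DecidableEq N] (R : Fin 3 → RankPref) (i : Fin 3) (p : RankPref) :
    extendMarket f (Function.update R i p) =
      Function.update (extendMarket f R) (f i) (p.toMixed f) := by
  funext x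
  by_cases hx : ∃ j, f j = x
  · obtain ⟨j, rfl⟩ := hx
    by_cases hj : j = i
    · subst hj
      simp
    · simp [hj]
  · have : x ≠ f i := fun e => hx ⟨i, e.symm⟩
    simp [this, extendMarket_of_notMem f _ hx]

theorem toMixed_sPref_iff (p : RankPref) (i : Fin 3) (σ τ : Equiv.Perm (Fin 3)) :
    (p.toMixed f).SPref (f i) (σ.viaEmbedding f) (τ.viaEmbedding f) ↔ p.Strict i σ τ := by
  simp [MixedLexPref.SPref, RankPref.Strict, RankPref.toMixed, viaEmbedding_symm, SLO.ofRank,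
    Equiv.Perm.viaEmbedding_apply]

theorem toMixed_wPref_iff (p : RankPref) (i : Fin 3) (σ τ : Equiv.Perm (Fin 3)) :
    (p.toMixed f).WPref (f i) (σ.viaEmbedding f) (τ.viaEmbedding f) ↔ p.Weak i σ τ := by
  simp [MixedLexPref.WPref, RankPref.Weak, toMixed_sPref_iff, viaEmbedding_symm,
    Equiv.Perm.viaEmbedding_apply]

theorem exists_rankRational_of_mIndRational {R : Fin 3 → RankPref} {a : Equiv.Perm N}
    (ha : MIndRational (extendMarket f R) a) :
    ∃ σ : Equiv.Perm (Fin 3), σ.viaEmbedding f = a ∧ RankRational R σ := by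
  obtain ⟨σ, rfl⟩ : ∃ σ : Equiv.Perm (Fin 3), σ.viaEmbedding f = a := by
    refine exists_viaEmbedding_eq f fun x hx => ?_
    have h := ha x
    rw [extendMarket_of_notMem f R hx] at h
    rcases h with h | h
    · simp only [MixedLexPref.SPref, if_true, Equiv.Perm.one_apply] at h
      rcases h with h | h
      · exact absurd h (SLO.not_top_pref _ _)
      · exact h.1
    · exact h.1
  refine ⟨σ, rfl, fun i => ?_⟩
  have h := ha (f i)
  rwa [extendMarket_apply, ← viaEmbedding_one f, toMixed_wPref_iff] at h

theorem RankDom.mParetoDom {R : Fin 3 → RankPref} {τ σ : Equiv.Perm (Fin 3)}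
    (h : RankDom R τ σ) :
    MParetoDom (extendMarket f R) (τ.viaEmbedding f) (σ.viaEmbedding f) := by
  obtain ⟨hw, j, hj⟩ := h
  refine ⟨fun x => ?_, f j, ?_⟩
  · by_cases hx : ∃ i, f i = x
    · obtain ⟨i, rfl⟩ := hx
      rw [extendMarket_apply, toMixed_wPref_iff]
      exact hw i
    · right
      simp only [viaEmbedding_symm]
      constructor <;> rw [Equiv.Perm.viaEmbedding_apply_of_notMem _ _ _ hx,
        Equiv.Perm.viaEmbedding_apply_of_notMem _ _ _ hx]
  · rwa [extendMarket_apply, toMixed_sPref_iff]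

theorem RankBlocked.not_mPairwiseStable [DecidableEq N] {R : Fin 3 → RankPref}
    {σ : Equiv.Perm (Fin 3)} (h : RankBlocked R σ) :
    ¬ MPairwiseStable (extendMarket f R) (σ.viaEmbedding f) := by
  obtain ⟨i, j, hij, hi, hj⟩ := h
  refine not_not_intro ⟨f i, f j, f.injective.ne hij, ?_, ?_⟩
  · rwa [extendMarket_apply, ← viaEmbedding_mul_swap, toMixed_sPref_iff]
  · rwa [extendMarket_apply, ← viaEmbedding_mul_swap, toMixed_sPref_iff]

end Embedding

/-- If there are at least three agents, no rule on the domain of mixed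
lexicographic markets is individually rational, Pareto efficient and strategy-proof, and
no rule on this domain is individually rational, pairwise stable and strategy-proof. -/
theorem mixed_impossibility_paretoEfficiency_and_pairwiseStability {N : Type*} [Fintype N]
    [DecidableEq N] (hN : 3 ≤ Fintype.card N) :
    (∀ φ : (N → MixedLexPref N) → Equiv.Perm N,
      ¬ ((∀ P, MIndRational P (φ P)) ∧ (∀ P, MParetoEff P (φ P)) ∧
          (∀ (P : N → MixedLexPref N) (i : N) (P' : MixedLexPref N),
            (P i).WPref i (φ P) (φ (Function.update P i P'))))) ∧
    (∀ φ : (N → MixedLexPref N) → Equiv.Perm N,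
      ¬ ((∀ P, MIndRational P (φ P)) ∧ (∀ P, MPairwiseStable P (φ P)) ∧
          (∀ (P : N → MixedLexPref N) (i : N) (P' : MixedLexPref N),
            (P i).WPref i (φ P) (φ (Function.update P i P'))))) := by
  obtain ⟨f⟩ : Nonempty (Fin 3 ↪ N) :=
    Function.Embedding.nonempty_of_card_le (by simpa using hN)
  constructor
  · rintro φ ⟨hir, hpe, hsp⟩
    have hψ R := exists_rankRational_of_mIndRational f (hir (extendMarket f R))
    choose ψ hψ hrat using hψ
    have hadm : ∀ R, RankAdmissible R (ψ R) := fun R =>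
      ⟨hrat R, fun ⟨_, h⟩ => hpe (extendMarket f R) ⟨_, hψ R ▸ h.mParetoDom f⟩⟩
    have hstrat : ∀ (R : Fin 3 → RankPref) (i : Fin 3) (p : RankPref),
        (R i).Weak i (ψ R) (ψ (Function.update R i p)) := by
      intro R i p
      have := hsp (extendMarket f R) (f i) (p.toMixed f)
      rwa [← extendMarket_update, extendMarket_apply, ← hψ R, ← hψ (Function.update R i p),
        toMixed_wPref_iff] at this
    have hback : ∀ (R : Fin 3 → RankPref) (i : Fin 3) (p : RankPref),
        p.Weak i (ψ (Function.update R i p)) (ψ R) := by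
      intro R i p
      simpa using hstrat (Function.update R i p) i (R i)
    obtain ⟨R, p₀, p₂, h⟩ := exists_incompatible_deviations
    rcases h (ψ R) (hadm R) with h | h
    · exact h _ (hadm _) ⟨hstrat R 0 p₀, hback R 0 p₀⟩
    · exact h _ (hadm _) ⟨hstrat R 2 p₂, hback R 2 p₂⟩
  · rintro φ ⟨hir, hps, -⟩
    obtain ⟨R, hR⟩ := exists_rankBlocked_of_rankRational
    obtain ⟨σ, hσ, hrat⟩ := exists_rankRational_of_mIndRational f (hir (extendMarket f R))
    exact (hR σ hrat).not_mPairwiseStable f (hσ ▸ hps (extendMarket f R))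
end

section
/- There exist a strict demand lexicographic housing market ≽ with three agents and an allocation a that is pair efficient at ≽ but not pairwise stable at ≽; hence pair efficiency does not imply pairwise stability for demand lexicographic markets. -/
open Classical Function

/-- A strict demand lexicographic preference: strict demand order over houses and strict
supply order over agents, compared lexicographically demand-first. -/
structure SDemLexPref (N : Type*) where
  dem : SLO N
  sup : SLO N

variable {N : Type*}

/-- `a ≻ᵢ b` for strict demand lexicographic preferences. -/
def SDemLexPref.SPref (P : SDemLexPref N) (i : N) (a b : Equiv.Perm N) : Prop :=
  P.dem.pref (a i) (b i) ∨ (a i = b i ∧ P.sup.pref (a.symm i) (b.symm i))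

/-- `a ≽ᵢ b` for strict demand lexicographic preferences (`a ∼ᵢ b` iff the allotments
coincide). -/
def SDemLexPref.WPref (P : SDemLexPref N) (i : N) (a b : Equiv.Perm N) : Prop :=
  P.SPref i a b ∨ (a i = b i ∧ a.symm i = b.symm i)

section SProps
variable [DecidableEq N]

/-- Coalition `S` weakly blocks allocation `a` at the strict market `P`. -/
def SWeaklyBlocks (P : N → SDemLexPref N) (S : Finset N) (a : Equiv.Perm N) : Prop :=
  S.Nonempty ∧ ∃ b : Equiv.Perm N, S.image ⇑b = S ∧
    (∀ i ∈ S, (P i).WPref i b a) ∧ ∃ j ∈ S, (P j).SPref j b a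

/-- `a` is a strong core allocation of the strict market `P`. -/
def SIsStrongCore (P : N → SDemLexPref N) (a : Equiv.Perm N) : Prop :=
  ∀ S : Finset N, ¬ SWeaklyBlocks P S a

/-- `a` is individually rational at the strict market `P`. -/
def SIndRational (P : N → SDemLexPref N) (a : Equiv.Perm N) : Prop :=
  ∀ i : N, (P i).WPref i a 1

/-- `b` Pareto dominates `a` at the strict market `P`. -/
def SParetoDom (P : N → SDemLexPref N) (b a : Equiv.Perm N) : Prop :=
  (∀ i : N, (P i).WPref i b a) ∧ ∃ j : N, (P j).SPref j b a

/-- `a` is Pareto efficient at the strict market `P`. -/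
def SParetoEff (P : N → SDemLexPref N) (a : Equiv.Perm N) : Prop :=
  ¬ ∃ b : Equiv.Perm N, SParetoDom P b a

/-- `a` is pair efficient at the strict market `P`. -/
def SPairEff (P : N → SDemLexPref N) (a : Equiv.Perm N) : Prop :=
  ¬ ∃ i j : N, i ≠ j ∧ (P i).SPref i (a * Equiv.swap i j) a ∧
    (P j).SPref j (a * Equiv.swap i j) a ∧ SParetoDom P (a * Equiv.swap i j) a

/-- `a` is pairwise stable at the strict market `P`. -/
def SPairwiseStable (P : N → SDemLexPref N) (a : Equiv.Perm N) : Prop :=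
  ¬ ∃ i j : N, i ≠ j ∧ (P i).SPref i (a * Equiv.swap i j) a ∧
    (P j).SPref j (a * Equiv.swap i j) a

/-- `a` is stable at the strict market `P`. -/
def SStable (P : N → SDemLexPref N) (a : Equiv.Perm N) : Prop :=
  ¬ ∃ (b : Equiv.Perm N) (S : Finset N), S.Nonempty ∧ (∀ k ∉ S, b k = a k) ∧
      S.image ⇑b = S.image ⇑a ∧ ∀ i ∈ S, (P i).SPref i b a

end SProps

/-- The strict linear order preferring smaller elements. -/
def SLO.lt (N : Type*) [LinearOrder N] : SLO N where
  pref a b := a < b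
  trichotomous := lt_trichotomy
  irrefl := lt_irrefl
  trans _ _ _ := lt_trans

/-- The strict linear order preferring larger elements. -/
def SLO.gt (N : Type*) [LinearOrder N] : SLO N where
  pref a b := b < a
  trichotomous a b := (lt_trichotomy b a).imp_right (Or.imp_left Eq.symm)
  irrefl := lt_irrefl
  trans _ _ _ hab hbc := hbc.trans hab

/-- Agent `0` demands larger houses, the others demand smaller ones, and everybody prefers to
supply larger agents. -/
def threeAgentMarket : Fin 3 → SDemLexPref (Fin 3) :=
  ![⟨SLO.gt _, SLO.gt _⟩, ⟨SLO.lt _, SLO.gt _⟩, ⟨SLO.lt _, SLO.gt _⟩]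

theorem threeAgentMarket_sPref_zero (a b : Equiv.Perm (Fin 3)) :
    (threeAgentMarket 0).SPref 0 a b ↔ b 0 < a 0 ∨ (a 0 = b 0 ∧ b.symm 0 < a.symm 0) :=
  Iff.rfl

theorem threeAgentMarket_sPref_one (a b : Equiv.Perm (Fin 3)) :
    (threeAgentMarket 1).SPref 1 a b ↔ a 1 < b 1 ∨ (a 1 = b 1 ∧ b.symm 1 < a.symm 1) :=
  Iff.rfl

theorem threeAgentMarket_sPref_two (a b : Equiv.Perm (Fin 3)) :
    (threeAgentMarket 2).SPref 2 a b ↔ a 2 < b 2 ∨ (a 2 = b 2 ∧ b.symm 2 < a.symm 2) :=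
  Iff.rfl

/-- In the cyclic allocation, every exchange of two allotments makes agent `2` worse off. -/
theorem not_wPref_finRotate_mul_swap (i j : Fin 3) (hij : i ≠ j) :
    ¬ (threeAgentMarket 2).WPref 2 (finRotate 3 * Equiv.swap i j) (finRotate 3) := by
  rw [SDemLexPref.WPref, threeAgentMarket_sPref_two]
  revert i j
  decide

/-- There is a strict demand lexicographic market with three agents and
an allocation that is pair efficient but not pairwise stable. -/
theorem pairEfficient_not_pairwiseStable :
    ∃ (P : Fin 3 → SDemLexPref (Fin 3)) (a : Equiv.Perm (Fin 3)),
      SPairEff P a ∧ ¬ SPairwiseStable P a := by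
  refine ⟨threeAgentMarket, finRotate 3, ?_, ?_⟩
  · rintro ⟨i, j, hij, -, -, hdom, -⟩
    exact not_wPref_finRotate_mul_swap i j hij (hdom 2)
  · refine not_not_intro ⟨0, 1, by decide, ?_, ?_⟩
    · rw [threeAgentMarket_sPref_zero]
      decide
    · rw [threeAgentMarket_sPref_one]
      decide
end

section
/- There exist a strict demand lexicographic housing market ≽ with three agents, two distinct stable allocations a and b of ≽, and an agent i with a ≻ᵢ b; in particular, stable allocations of demand lexicographic markets need not be unique. -/
open Classical Function

variable {N : Type*}

/-- The strict linear order of a linearly ordered type, smaller elements being preferred. -/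
def SLO.ofLT (M : Type*) [LinearOrder M] : SLO M where
  pref := (· < ·)
  trichotomous := lt_trichotomy
  irrefl := lt_irrefl
  trans := fun _ _ _ => lt_trans

theorem SDemLexPref.not_sPref_self {M : Type*} (P : SDemLexPref M) (i : M)
    (a : Equiv.Perm M) : ¬ P.SPref i a a := by
  rintro (h | ⟨-, h⟩)
  · exact P.dem.irrefl _ h
  · exact P.sup.irrefl _ h

theorem Equiv.Perm.eq_of_forall_le {n : ℕ} {a b : Equiv.Perm (Fin n)}
    (h : ∀ i, b i ≤ a i) : b = a := by
  have hsum : ∑ i, (b i : ℕ) = ∑ i, (a i : ℕ) :=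
    (Equiv.sum_comp b (fun i : Fin n => (i : ℕ))).trans
      (Equiv.sum_comp a (fun i : Fin n => (i : ℕ))).symm
  have heq := (Finset.sum_eq_sum_iff_of_le fun i _ => Fin.le_def.mp (h i)).mp hsum
  exact Equiv.ext fun i => Fin.ext (heq i (Finset.mem_univ i))

/-- If all agents rank the houses in the same way, every allocation is stable. -/
theorem sStable_of_common_demand {n : ℕ} (P : Fin n → SDemLexPref (Fin n))
    (hP : ∀ i, (P i).dem = SLO.ofLT (Fin n)) (a : Equiv.Perm (Fin n)) : SStable P a := by
  rintro ⟨b, S, ⟨j, hj⟩, hout, -, hS⟩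
  have hle : ∀ i, b i ≤ a i := by
    intro i
    by_cases hi : i ∈ S
    · rcases hS i hi with h | ⟨h, -⟩
      · rw [hP] at h
        exact le_of_lt h
      · exact h.le
    · exact (hout i hi).le
  obtain rfl := Equiv.Perm.eq_of_forall_le hle
  exact (P j).not_sPref_self j b (hS j hj)

/-- There is a strict demand lexicographic market with three agents
having two distinct stable allocations, one of which some agent strictly prefers. -/
theorem stable_not_unique :
    ∃ (P : Fin 3 → SDemLexPref (Fin 3)) (a b : Equiv.Perm (Fin 3)) (i : Fin 3),
      a ≠ b ∧ SStable P a ∧ SStable P b ∧ (P i).SPref i a b := by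
  refine ⟨fun _ => ⟨SLO.ofLT _, SLO.ofLT _⟩, 1, Equiv.swap 0 1, 0, ?_,
    sStable_of_common_demand _ (fun _ => rfl) _,
    sStable_of_common_demand _ (fun _ => rfl) _, Or.inl ?_⟩
  · decide
  · change (1 : Equiv.Perm (Fin 3)) 0 < Equiv.swap 0 1 0
    decide
end
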